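/- arXiv:2605.21636 — 8 statements merged into one kernel-verified Lean document; each statement's English description precedes it below -/
import Mathlib

section
/- Let X ⊆ ℝ^d be finite, γ : X → ℝ², p ∈ ℝ², and r ≥ 0. Let TelOffset_{p,r} = ⋃_{x ∈ X} Ball_r(x) × {q ∈ ℝ² : γ(x) ≤ q and q ≤ p} ⊆ ℝ^d × ℝ², and let Offset_{p,r} = ⋃_{x ∈ X, γ(x) ≤ p} Ball_r(x) ⊆ ℝ^d. Then the projection map TelOffset_{p,r} → Offset_{p,r}, (w,q) ↦ w, is a homotopy equivalence (with homotopy inverse w ↦ (w,p)). -/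
noncomputable section

attribute [local instance] Classical.propDecidable

/-- Euclidean space ℝ^d. -/
abbrev Pt (d : ℕ) := EuclideanSpace ℝ (Fin d)

variable {d : ℕ}

/-- The sphere with center `c` and radius `r` is a circumsphere of the finite set `Q`:
every point of `Q` lies on it. -/
def OnSphere (c : Pt d) (r : ℝ) (Q : Finset (Pt d)) : Prop :=
  ∀ w ∈ Q, ‖w - c‖ = r

/-- The sphere with center `c` and radius `r` is `Z`-empty: no point of `Z` lies inside it. -/
def SphEmpty (c : Pt d) (r : ℝ) (Z : Finset (Pt d)) : Prop :=
  ∀ z ∈ Z, ¬ ‖z - c‖ < r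

/-- The Delaunay triangulation of `Z`: nonempty subsets of `Z` admitting a `Z`-empty
circumsphere. -/
def DelT (Z : Finset (Pt d)) : Set (Finset (Pt d)) :=
  {σ | σ.Nonempty ∧ σ ⊆ Z ∧ ∃ c r, 0 ≤ r ∧ OnSphere c r σ ∧ SphEmpty c r Z}

/-- `Z` is in general position: every nonempty subset `Q` of at most `d+1` points is affinely
independent, and no point of `Z \ Q` lies on the smallest circumsphere of `Q`. -/
def GenPos (Z : Finset (Pt d)) : Prop :=
  ∀ Q : Finset (Pt d), Q ⊆ Z → Q.Nonempty → Q.card ≤ d + 1 →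
    (AffineIndependent ℝ (fun q : ↥(Q : Set (Pt d)) => (q : Pt d))) ∧
    ∀ c r, 0 ≤ r → OnSphere c r Q →
      (∀ c' r', 0 ≤ r' → OnSphere c' r' Q → r ≤ r') →
      ∀ z ∈ Z, z ∉ Q → ‖z - c‖ ≠ r

/-- The sublevel set `X_p = {x ∈ X : γ(x) ≤ p}` (product order on `ℝ²`). -/
def Xsub (X : Finset (Pt d)) (γ : Pt d → ℝ × ℝ) (p : ℝ × ℝ) : Finset (Pt d) :=
  X.filter fun z => γ z ≤ p

/-- `x` is the point of `σ` with largest `γ₁`-value. -/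
def IsMax1 (γ : Pt d → ℝ × ℝ) (σ : Finset (Pt d)) (x : Pt d) : Prop :=
  x ∈ σ ∧ ∀ z ∈ σ, (γ z).1 ≤ (γ x).1

/-- `y` is the point of `σ` with largest `γ₂`-value. -/
def IsMax2 (γ : Pt d → ℝ × ℝ) (σ : Finset (Pt d)) (y : Pt d) : Prop :=
  y ∈ σ ∧ ∀ z ∈ σ, (γ z).2 ≤ (γ y).2

/-- The sphere of center `c` and radius `r` is a witness of `σ`, where `x = max₁(σ)` and
`y = max₂(σ)`: it is a circumsphere of `σ \ {x,y}`, `x` and `y` lie inside or on it, and it is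
`(X_{γ(σ)} \ {x,y})`-empty (note `γ(σ) = (γ₁ x, γ₂ y)`). -/
def IsWitness (X : Finset (Pt d)) (γ : Pt d → ℝ × ℝ) (σ : Finset (Pt d))
    (x y c : Pt d) (r : ℝ) : Prop :=
  (∀ z ∈ σ, z ≠ x → z ≠ y → ‖z - c‖ = r) ∧
  ‖x - c‖ ≤ r ∧ ‖y - c‖ ≤ r ∧
  ∀ w ∈ Xsub X γ ((γ x).1, (γ y).2), w ≠ x → w ≠ y → ¬ ‖w - c‖ < r

/-- The incremental Delaunay complex `Incr(γ)`: nonempty subsets of `X` admitting a witness. -/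
def Incr (X : Finset (Pt d)) (γ : Pt d → ℝ × ℝ) : Set (Finset (Pt d)) :=
  {σ | σ.Nonempty ∧ σ ⊆ X ∧
    ∃ x y c r, IsMax1 γ σ x ∧ IsMax2 γ σ y ∧ 0 ≤ r ∧ IsWitness X γ σ x y c r}

/-- The incremental Delaunay radius `ω_σ`: the minimum radius of a witness of `σ`. -/
def omegaRad (X : Finset (Pt d)) (γ : Pt d → ℝ × ℝ) (σ : Finset (Pt d)) : ℝ :=
  sInf {r | 0 ≤ r ∧ ∃ x y c, IsMax1 γ σ x ∧ IsMax2 γ σ y ∧ IsWitness X γ σ x y c r}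

/-- `γ(σ)`: the coordinatewise maximum of `γ` over the nonempty finite set `σ`. -/
def gammaJoin (γ : Pt d → ℝ × ℝ) (σ : Finset (Pt d)) (h : σ.Nonempty) : ℝ × ℝ :=
  (σ.sup' h fun z => (γ z).1, σ.sup' h fun z => (γ z).2)

/-- `(σ, x)` is a conflict pair at `p ∈ Grid(γ)`: `σ` is a `d`-simplex of `DelT(X_p)`, `x` lies
inside the circumsphere of `σ`, and either `p₁ < max(im γ₁)` and `x ∈ X_{p→}`, or
`p₂ < max(im γ₂)` and `x ∈ X_{p↑}` (the successor being expressed by its defining property). -/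
def ConflictAt (X : Finset (Pt d)) (γ : Pt d → ℝ × ℝ) (p : ℝ × ℝ)
    (σ : Finset (Pt d)) (x : Pt d) : Prop :=
  p.1 ∈ X.image (fun z => (γ z).1) ∧ p.2 ∈ X.image (fun z => (γ z).2) ∧
  σ ∈ DelT (Xsub X γ p) ∧ σ.card = d + 1 ∧
  (∃ c r, 0 ≤ r ∧ OnSphere c r σ ∧ ‖x - c‖ < r) ∧
  ((∃ a ∈ X.image (fun z => (γ z).1), p.1 < a ∧
      (∀ b ∈ X.image (fun z => (γ z).1), p.1 < b → a ≤ b) ∧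
      x ∈ Xsub X γ (a, p.2)) ∨
   (∃ a ∈ X.image (fun z => (γ z).2), p.2 < a ∧
      (∀ b ∈ X.image (fun z => (γ z).2), p.2 < b → a ≤ b) ∧
      x ∈ Xsub X γ (p.1, a)))

/-- `(σ, x)` is a conflict pair: it is a conflict pair at some `p ∈ Grid(γ)`. -/
def ConflictPair (X : Finset (Pt d)) (γ : Pt d → ℝ × ℝ)
    (σ : Finset (Pt d)) (x : Pt d) : Prop :=
  ∃ p, ConflictAt X γ p σ x

/-- `Δ` witnesses the Δ-property of `X`: `Δ` consists of `d+1` points of `X` which come first in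
both the `γ₁`- and `γ₂`-orders, the two orders agree on `Δ`, and `X` is contained in the convex
hull of `Δ`. -/
def IsDelta (X : Finset (Pt d)) (γ : Pt d → ℝ × ℝ) (Δ : Finset (Pt d)) : Prop :=
  Δ ⊆ X ∧ Δ.card = d + 1 ∧
  (∀ a ∈ Δ, ∀ b ∈ X, b ∉ Δ → (γ a).1 < (γ b).1 ∧ (γ a).2 < (γ b).2) ∧
  (∀ a ∈ Δ, ∀ b ∈ Δ, ((γ a).1 ≤ (γ b).1 ↔ (γ a).2 ≤ (γ b).2)) ∧
  (↑X : Set (Pt d)) ⊆ convexHull ℝ (↑Δ : Set (Pt d))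

/-- The Voronoi cell of `x` with respect to `Y`. -/
def VorCell (x : Pt d) (Y : Set (Pt d)) : Set (Pt d) :=
  {w | ∀ y ∈ Y, ‖w - x‖ ≤ ‖w - y‖}

/-- The telescopic Voronoi cell `Tel(x)`: the closure of `⋃_{q ≥ γ(x)} Vor(x, X_q) × {q}`. -/
def Tel (X : Finset (Pt d)) (γ : Pt d → ℝ × ℝ) (x : Pt d) : Set (Pt d × (ℝ × ℝ)) :=
  closure {z | γ x ≤ z.2 ∧ z.1 ∈ VorCell x (↑(Xsub X γ z.2) : Set (Pt d))}

/-- The telescopic Voronoi ball `TelVor(x)_{p,r}`. -/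
def TelVor (X : Finset (Pt d)) (γ : Pt d → ℝ × ℝ) (x : Pt d) (p : ℝ × ℝ) (r : ℝ) :
    Set (Pt d × (ℝ × ℝ)) :=
  Tel X γ x ∩ {z | z.1 ∈ Metric.closedBall x r ∧ z.2 ≤ p}

/-- The telescopic Voronoi cell `TelVor(x)_{p,∞}`. -/
def TelVorInf (X : Finset (Pt d)) (γ : Pt d → ℝ × ℝ) (x : Pt d) (p : ℝ × ℝ) :
    Set (Pt d × (ℝ × ℝ)) :=
  Tel X γ x ∩ {z | z.2 ≤ p}

/-- The radius of the smallest enclosing ball of `σ`. -/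
def miniballRadius (σ : Finset (Pt d)) : ℝ :=
  sInf {r | 0 ≤ r ∧ ∃ c : Pt d, ∀ x ∈ σ, ‖x - c‖ ≤ r}

/-- The Delaunay radius `b_σ`: the minimum radius of a `Z`-empty circumsphere of `σ`. -/
def delRad (Z σ : Finset (Pt d)) : ℝ :=
  sInf {r | 0 ≤ r ∧ ∃ c, OnSphere c r σ ∧ SphEmpty c r Z}

/-- The telescopic offset `TelOffset_{p,r} ⊆ ℝ^d × ℝ²`. -/
def TelOffsetSet (X : Finset (Pt d)) (γ : Pt d → ℝ × ℝ) (p : ℝ × ℝ) (r : ℝ) :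
    Set (Pt d × (ℝ × ℝ)) :=
  ⋃ x ∈ X, Metric.closedBall x r ×ˢ {q : ℝ × ℝ | γ x ≤ q ∧ q ≤ p}

/-- The sublevel offset `Offset_{p,r} ⊆ ℝ^d`. -/
def OffsetSet (X : Finset (Pt d)) (γ : Pt d → ℝ × ℝ) (p : ℝ × ℝ) (r : ℝ) : Set (Pt d) :=
  ⋃ x ∈ Xsub X γ p, Metric.closedBall x r

/-- `OU_r = ⋃_{x ∈ X} Ball_r(x) × Vor(x,X) ⊆ ℝ^d × ℝ^d`. -/
def OUSet (X : Finset (Pt d)) (r : ℝ) : Set (Pt d × Pt d) :=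
  ⋃ x ∈ X, Metric.closedBall x r ×ˢ VorCell x (↑X : Set (Pt d))

/-- `Offset(X)_r = ⋃_{x ∈ X} Ball_r(x) ⊆ ℝ^d`. -/
def OffsetR (X : Finset (Pt d)) (r : ℝ) : Set (Pt d) :=
  ⋃ x ∈ X, Metric.closedBall x r

/-- `OTelDC_{p,r} ⊆ ℝ^d × ℝ^d × ℝ²`. -/
def OTelDCSet (X : Finset (Pt d)) (γ : Pt d → ℝ × ℝ) (p : ℝ × ℝ) (r : ℝ) :
    Set (Pt d × Pt d × (ℝ × ℝ)) :=
  {z | z.2.2 ≤ p ∧ ∃ x ∈ Xsub X γ z.2.2,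
    ‖x - z.1‖ ≤ r ∧ z.2.1 ∈ VorCell x (↑(Xsub X γ z.2.2) : Set (Pt d))}

theorem mem_TelOffsetSet {X : Finset (Pt d)} {γ : Pt d → ℝ × ℝ} {p : ℝ × ℝ} {r : ℝ}
    {z : Pt d × (ℝ × ℝ)} :
    z ∈ TelOffsetSet X γ p r ↔ ∃ x ∈ X, z.1 ∈ Metric.closedBall x r ∧ z.2 ∈ Set.Icc (γ x) p := by
  simp only [TelOffsetSet, Set.mem_iUnion, Set.mem_prod, exists_prop, Set.mem_ofPred_eq, Set.mem_Icc]

theorem mem_OffsetSet {X : Finset (Pt d)} {γ : Pt d → ℝ × ℝ} {p : ℝ × ℝ} {r : ℝ} {w : Pt d} :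
    w ∈ OffsetSet X γ p r ↔ ∃ x ∈ X, γ x ≤ p ∧ w ∈ Metric.closedBall x r := by
  simp only [OffsetSet, Xsub, Set.mem_iUnion, Finset.mem_filter, exists_prop, and_assoc]

theorem fst_mem_OffsetSet {X : Finset (Pt d)} {γ : Pt d → ℝ × ℝ} {p : ℝ × ℝ} {r : ℝ}
    {z : Pt d × (ℝ × ℝ)} (hz : z ∈ TelOffsetSet X γ p r) : z.1 ∈ OffsetSet X γ p r := by
  obtain ⟨x, hx, hball, hIcc⟩ := mem_TelOffsetSet.1 hz
  exact mem_OffsetSet.2 ⟨x, hx, hIcc.1.trans hIcc.2, hball⟩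

theorem prodMk_mem_TelOffsetSet {X : Finset (Pt d)} {γ : Pt d → ℝ × ℝ} {p : ℝ × ℝ} {r : ℝ}
    {w : Pt d} (hw : w ∈ OffsetSet X γ p r) : (w, p) ∈ TelOffsetSet X γ p r := by
  obtain ⟨x, hx, hle, hball⟩ := mem_OffsetSet.1 hw
  exact mem_TelOffsetSet.2 ⟨x, hx, hball, hle, le_rfl⟩

/-- The fibres of the telescopic offset are star-shaped about `p`. -/
theorem lineMap_mem_TelOffsetSet {X : Finset (Pt d)} {γ : Pt d → ℝ × ℝ} {p : ℝ × ℝ} {r : ℝ}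
    {z : Pt d × (ℝ × ℝ)} (hz : z ∈ TelOffsetSet X γ p r) {t : ℝ} (ht : t ∈ Set.Icc (0 : ℝ) 1) :
    (z.1, AffineMap.lineMap p z.2 t) ∈ TelOffsetSet X γ p r := by
  obtain ⟨x, hx, hball, hIcc⟩ := mem_TelOffsetSet.1 hz
  exact mem_TelOffsetSet.2 ⟨x, hx, hball, (convex_Icc (γ x) p).lineMap_mem
    (Set.right_mem_Icc.2 (hIcc.1.trans hIcc.2)) hIcc ht⟩

/-- The projection `TelOffset_{p,r} → Offset_{p,r}`, `(w,q) ↦ w`, is a homotopy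
equivalence, with homotopy inverse `w ↦ (w,p)`. -/
theorem telOffsetProjHomotopyEquiv
    {d : ℕ} (hd : 1 ≤ d) (X : Finset (Pt d)) (γ : Pt d → ℝ × ℝ)
    (p : ℝ × ℝ) (r : ℝ) (hr : 0 ≤ r) :
    ∃ (f : C(↥(TelOffsetSet X γ p r), ↥(OffsetSet X γ p r)))
      (g : C(↥(OffsetSet X γ p r), ↥(TelOffsetSet X γ p r))),
      (∀ z : ↥(TelOffsetSet X γ p r), (f z : Pt d) = (z : Pt d × (ℝ × ℝ)).1) ∧
      (∀ w : ↥(OffsetSet X γ p r), (g w : Pt d × (ℝ × ℝ)) = ((w : Pt d), p)) ∧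
      (f.comp g).Homotopic (ContinuousMap.id ↥(OffsetSet X γ p r)) ∧
      (g.comp f).Homotopic (ContinuousMap.id ↥(TelOffsetSet X γ p r)) := by
  refine ⟨⟨fun z => ⟨z.1.1, fst_mem_OffsetSet z.2⟩, by fun_prop⟩,
    ⟨fun w => ⟨(w.1, p), prodMk_mem_TelOffsetSet w.2⟩, by fun_prop⟩,
    fun _ => rfl, fun _ => rfl, ContinuousMap.Homotopic.refl _, ⟨?_⟩⟩
  exact
    { toFun := fun tz => ⟨(tz.2.1.1, AffineMap.lineMap p tz.2.1.2 (tz.1 : ℝ)),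
        lineMap_mem_TelOffsetSet tz.2.2 tz.1.2⟩
      continuous_toFun := by
        simp only [AffineMap.lineMap_apply_module]
        fun_prop
      map_zero_left := fun z => by simp
      map_one_left := fun z => by simp }
end
end

section
/- For every nonempty σ ⊆ X and every (p,r) ∈ ℝ² × [0,∞): if the intersection ⋂_{x ∈ σ} TelVor(x)_{p,r} is nonempty, then it is a contractible subspace of ℝ^d × ℝ². -/
noncomputable section

attribute [local instance] Classical.propDecidable

variable {d : ℕ}

/-- By injectivity of the two grades, the closure defining `Tel X γ x` amounts to keeping only the
Voronoi constraints of the points whose grades are both strictly smaller. -/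
theorem mem_Tel_iff {d : ℕ} {X : Finset (Pt d)} {γ : Pt d → ℝ × ℝ}
    (hinj1 : Set.InjOn (fun z => (γ z).1) (↑X : Set (Pt d)))
    (hinj2 : Set.InjOn (fun z => (γ z).2) (↑X : Set (Pt d)))
    {x : Pt d} (hx : x ∈ X) (z : Pt d × (ℝ × ℝ)) :
    z ∈ Tel X γ x ↔ γ x ≤ z.2 ∧
      ∀ y ∈ X, (γ y).1 < z.2.1 ∧ (γ y).2 < z.2.2 → ‖z.1 - x‖ ≤ ‖z.1 - y‖ := by
  constructor
  · suffices h : Tel X γ x ⊆ {z : Pt d × (ℝ × ℝ) | γ x ≤ z.2 ∧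
        ∀ y ∈ X, (γ y).1 < z.2.1 ∧ (γ y).2 < z.2.2 → ‖z.1 - x‖ ≤ ‖z.1 - y‖} from fun hz => h hz
    refine closure_minimal ?_ ?_
    · rintro z ⟨h1, h2⟩
      refine ⟨h1, fun y hy hlt => h2 y ?_⟩
      simp only [Xsub, Finset.coe_filter, Set.mem_ofPred_eq]
      exact ⟨hy, hlt.1.le, hlt.2.le⟩
    · simp only [Set.ofPred_and, Set.ofPred_forall]
      refine (isClosed_le continuous_const continuous_snd).inter ?_
      refine isClosed_iInter fun y => isClosed_iInter fun _ => isClosed_imp ?_ ?_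
      · exact (isOpen_lt continuous_const (continuous_fst.comp continuous_snd)).inter
          (isOpen_lt continuous_const (continuous_snd.comp continuous_snd))
      · exact isClosed_le (by fun_prop) (by fun_prop)
  · obtain ⟨w, q⟩ := z
    rintro ⟨h1, h2⟩
    have hcont : Continuous fun t : ℝ => (w, AffineMap.lineMap (k := ℝ) q (γ x) t) := by
      fun_prop
    have ht : Filter.Tendsto (fun t : ℝ => (w, AffineMap.lineMap (k := ℝ) q (γ x) t))
        (nhdsWithin 0 (Set.Ioi 0)) (nhds (w, q)) := by
      have := hcont.tendsto 0
      rw [AffineMap.lineMap_apply_zero] at this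
      exact this.mono_left nhdsWithin_le_nhds
    refine mem_closure_of_tendsto ht ?_
    filter_upwards [Ioo_mem_nhdsGT (zero_lt_one' ℝ)] with t ⟨ht0, ht1⟩
    obtain ⟨hq1, hq2⟩ := h1
    simp only at hq1 hq2
    have e1 : (AffineMap.lineMap (k := ℝ) q (γ x) t).1 = q.1 + t * ((γ x).1 - q.1) := by
      simp [AffineMap.lineMap_apply]; ring
    have e2 : (AffineMap.lineMap (k := ℝ) q (γ x) t).2 = q.2 + t * ((γ x).2 - q.2) := by
      simp [AffineMap.lineMap_apply]; ring
    refine ⟨⟨?_, ?_⟩, fun y hy => ?_⟩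
    · simp only [e1]; nlinarith
    · simp only [e2]; nlinarith
    · simp only [Xsub, Finset.coe_filter, Set.mem_ofPred_eq] at hy
      obtain ⟨hyX, hy1, hy2⟩ := hy
      rw [e1] at hy1
      rw [e2] at hy2
      by_cases hyx : y = x
      · rw [hyx]
      refine h2 y hyX ⟨?_, ?_⟩
      · rcases hq1.lt_or_eq with h | h
        · nlinarith
        · refine lt_of_le_of_ne (by nlinarith) fun h' => hyx (hinj1 hyX hx ?_)
          exact h'.trans h.symm
      · rcases hq2.lt_or_eq with h | h
        · nlinarith
        · refine lt_of_le_of_ne (by nlinarith) fun h' => hyx (hinj2 hyX hx ?_)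
          exact h'.trans h.symm

/-- The points at least as close to `x` as to `y` form a convex set. -/
theorem convex_setOf_norm_sub_le_norm_sub {E : Type*} [NormedAddCommGroup E]
    [InnerProductSpace ℝ E] (x y : E) : Convex ℝ {w : E | ‖w - x‖ ≤ ‖w - y‖} := by
  have h : {w : E | ‖w - x‖ ≤ ‖w - y‖} =
      {w : E | innerₗ E (y - x) w ≤ (‖y‖ ^ 2 - ‖x‖ ^ 2) / 2} := by
    ext w
    simp only [Set.mem_ofPred_eq, innerₗ_apply_apply]
    rw [← sq_le_sq₀ (norm_nonneg _) (norm_nonneg _), norm_sub_sq_real, norm_sub_sq_real,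
      inner_sub_left, real_inner_comm w y, real_inner_comm w x]
    constructor <;> intro h <;> linarith
  rw [h]
  exact convex_halfSpace_le (innerₗ E (y - x)).isLinear _

/-- Two continuous self-maps of a set are homotopic if the segments joining corresponding values
stay in the set. -/
theorem homotopic_of_segment_subset {E : Type*} [AddCommGroup E] [Module ℝ E]
    [TopologicalSpace E] [IsTopologicalAddGroup E] [ContinuousSMul ℝ E] {S : Set E} (f g : C(S, S))
    (h : ∀ s, segment ℝ (f s : E) (g s) ⊆ S) : f.Homotopic g := by
  refine ⟨⟨⟨fun a => ⟨AffineMap.lineMap (k := ℝ) (f a.2 : E) (g a.2) (a.1 : ℝ), ?_⟩, ?_⟩, ?_, ?_⟩⟩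
  · refine h a.2 ?_
    rw [segment_eq_image_lineMap]
    exact ⟨a.1, a.1.2, rfl⟩
  · refine Continuous.subtype_mk ?_ _
    simp only [AffineMap.lineMap_apply_module]
    fun_prop
  · intro s
    ext
    simp
  · intro s
    ext
    simp

/-- A set in a product whose slices are convex over one bottom parameter `g`, and which contains,
with each of its points `(w, q)`, the segment from it to `(w, g)`, is contractible. -/
theorem contractibleSpace_of_segment_subset_of_convex_slice {E F : Type*}
    [AddCommGroup E] [Module ℝ E] [TopologicalSpace E] [IsTopologicalAddGroup E]
    [ContinuousSMul ℝ E] [AddCommGroup F] [Module ℝ F] [TopologicalSpace F]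
    [IsTopologicalAddGroup F] [ContinuousSMul ℝ F] {S : Set (E × F)} (hS : S.Nonempty) (g : F)
    (hseg : ∀ z ∈ S, segment ℝ z (z.1, g) ⊆ S) (hconv : Convex ℝ {w | (w, g) ∈ S}) :
    ContractibleSpace S := by
  obtain ⟨z₀, hz₀⟩ := hS
  have hbot : ∀ z ∈ S, (z.1, g) ∈ S := fun z hz => hseg z hz (right_mem_segment ℝ _ _)
  let proj : C(S, S) := ⟨fun s => ⟨(s.1.1, g), hbot s.1 s.2⟩, by fun_prop⟩
  rw [contractible_iff_id_nullhomotopic]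
  refine ⟨⟨(z₀.1, g), hbot z₀ hz₀⟩,
    (homotopic_of_segment_subset (ContinuousMap.id S) proj fun s => hseg s.1 s.2).trans
      (homotopic_of_segment_subset proj _ fun s => ?_)⟩
  change segment ℝ (s.1.1, g) (z₀.1, g) ⊆ S
  rw [← Prod.image_mk_segment_left]
  rintro _ ⟨w, hw, rfl⟩
  exact hconv.segment_subset (hbot s.1 s.2) (hbot z₀ hz₀) hw

/-- Nonempty intersections of telescopic Voronoi balls are contractible. -/
theorem telVorIntersectionContractible
    {d : ℕ} (hd : 1 ≤ d) (X : Finset (Pt d)) (γ : Pt d → ℝ × ℝ)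
    (hgen : GenPos X)
    (hinj1 : Set.InjOn (fun z => (γ z).1) (↑X : Set (Pt d)))
    (hinj2 : Set.InjOn (fun z => (γ z).2) (↑X : Set (Pt d)))
    (σ : Finset (Pt d)) (hne : σ.Nonempty) (hsub : σ ⊆ X)
    (p : ℝ × ℝ) (r : ℝ) (hr : 0 ≤ r)
    (hint : (⋂ x ∈ σ, TelVor X γ x p r).Nonempty) :
    ContractibleSpace ↥(⋂ x ∈ σ, TelVor X γ x p r) := by
  have hmem : ∀ z : Pt d × (ℝ × ℝ), z ∈ (⋂ x ∈ σ, TelVor X γ x p r) ↔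
      ∀ x ∈ σ, (γ x ≤ z.2 ∧
        ∀ y ∈ X, (γ y).1 < z.2.1 ∧ (γ y).2 < z.2.2 → ‖z.1 - x‖ ≤ ‖z.1 - y‖) ∧
        z.1 ∈ Metric.closedBall x r ∧ z.2 ≤ p := by
    intro z
    simp only [Set.mem_iInter]
    exact forall₂_congr fun x hx => and_congr (mem_Tel_iff hinj1 hinj2 (hsub hx) z) Iff.rfl
  refine contractibleSpace_of_segment_subset_of_convex_slice hint (σ.sup' hne γ) ?_ ?_
  · rintro ⟨w, q⟩ hz
    rw [hmem] at hz
    have hgq : σ.sup' hne γ ≤ q := Finset.sup'_le _ _ fun x hx => (hz x hx).1.1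
    rw [← Prod.image_mk_segment_right, segment_symm]
    rintro _ ⟨q', hq', rfl⟩
    obtain ⟨hgq', hq'q⟩ := segment_subset_Icc hgq hq'
    rw [hmem]
    intro x hx
    obtain ⟨⟨-, h2⟩, h3, h4⟩ := hz x hx
    exact ⟨⟨(Finset.le_sup' γ hx).trans hgq', fun y hy hlt =>
      h2 y hy ⟨hlt.1.trans_le hq'q.1, hlt.2.trans_le hq'q.2⟩⟩, h3, hq'q.trans h4⟩
  · intro w hw w' hw' a b ha hb hab
    simp only [Set.mem_ofPred_eq, hmem] at hw hw' ⊢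
    intro x hx
    obtain ⟨⟨h1, h2⟩, h3, h4⟩ := hw x hx
    obtain ⟨⟨-, h2'⟩, h3', -⟩ := hw' x hx
    exact ⟨⟨h1, fun y hy hlt =>
      convex_setOf_norm_sub_le_norm_sub x y (h2 y hy hlt) (h2' y hy hlt) ha hb hab⟩,
      convex_closedBall x r h3 h3' ha hb hab, h4⟩
end
end

section
/- For every nonempty σ ⊆ X and every p ∈ ℝ²: the intersection ⋂_{x ∈ σ} TelVor(x)_{p,∞} is nonempty if and only if σ ∈ Incr(γ) and γ(σ) ≤ p. -/
noncomputable section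

attribute [local instance] Classical.propDecidable

variable {d : ℕ}

/-- A point `u` competes with `x` on one axis at level `t` when its value `b` lies below `t`
strictly, or weakly if the value `a` of `x` equals `t`. The closure `Tel(x)` consists of the
`(w, s)` with `γ(x) ≤ s` for which `x` is a nearest site of `w` among those competing on both
axes. -/
theorem mem_tel_iff {X : Finset (Pt d)} {γ : Pt d → ℝ × ℝ} {x w : Pt d} {s : ℝ × ℝ} :
    (w, s) ∈ Tel X γ x ↔ γ x ≤ s ∧ ∀ u ∈ X,
      ((γ u).1 < s.1 ∨ (γ u).1 ≤ s.1 ∧ (γ x).1 = s.1) →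
      ((γ u).2 < s.2 ∨ (γ u).2 ≤ s.2 ∧ (γ x).2 = s.2) → ‖w - x‖ ≤ ‖w - u‖ := by
  constructor
  · intro h
    have hx : γ x ≤ s := by
      have hc : IsClosed {z : Pt d × (ℝ × ℝ) | γ x ≤ z.2} :=
        isClosed_le continuous_const continuous_snd
      exact closure_minimal (fun z hz => hz.1) hc h
    refine ⟨hx, fun u hu h₁ h₂ => ?_⟩
    obtain ⟨f, hf, hlim⟩ := mem_closure_iff_seq_limit.1 h
    have hw := (continuous_fst.tendsto _).comp hlim
    have hs := (continuous_snd.tendsto _).comp hlim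
    have hs₁ := (continuous_fst.tendsto _).comp hs
    have hs₂ := (continuous_snd.tendsto _).comp hs
    have e₁ : ∀ᶠ n in Filter.atTop, (γ u).1 ≤ (f n).2.1 := by
      rcases h₁ with h₁ | h₁
      · exact (hs₁.eventually (lt_mem_nhds h₁)).mono fun _ hn => hn.le
      · exact .of_forall fun n => (h₁.1.trans h₁.2.ge).trans (hf n).1.1
    have e₂ : ∀ᶠ n in Filter.atTop, (γ u).2 ≤ (f n).2.2 := by
      rcases h₂ with h₂ | h₂
      · exact (hs₂.eventually (lt_mem_nhds h₂)).mono fun _ hn => hn.le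
      · exact .of_forall fun n => (h₂.1.trans h₂.2.ge).trans (hf n).1.2
    refine le_of_tendsto_of_tendsto (hw.sub_const x).norm (hw.sub_const u).norm ?_
    filter_upwards [e₁, e₂] with n h₁ h₂
    exact (hf n).2 u (by simpa [Xsub] using ⟨hu, h₁, h₂⟩)
  · rintro ⟨hx, h⟩
    have approx : ∀ a t : ℝ, a ≤ t → ∃ g : ℕ → ℝ, Filter.Tendsto g Filter.atTop (nhds t) ∧
        ∀ n, a ≤ g n ∧ ∀ b, b ≤ g n → b < t ∨ b ≤ t ∧ a = t := by
      intro a t hat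
      rcases hat.eq_or_lt with rfl | hlt
      · exact ⟨fun _ => a, tendsto_const_nhds, fun _ => ⟨le_rfl, fun _ hb => .inr ⟨hb, rfl⟩⟩⟩
      · obtain ⟨g, -, hg, hlim⟩ := exists_seq_strictMono_tendsto' hlt
        exact ⟨g, hlim, fun n => ⟨(hg n).1.le, fun _ hb => .inl (hb.trans_lt (hg n).2)⟩⟩
    obtain ⟨g₁, l₁, hg₁⟩ := approx _ _ hx.1
    obtain ⟨g₂, l₂, hg₂⟩ := approx _ _ hx.2
    refine mem_closure_iff_seq_limit.2 ⟨fun n => (w, (g₁ n, g₂ n)), fun n =>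
      ⟨⟨(hg₁ n).1, (hg₂ n).1⟩, fun u hu => ?_⟩,
      tendsto_const_nhds.prodMk_nhds (l₁.prodMk_nhds l₂)⟩
    obtain ⟨huX, hu₁, hu₂⟩ : u ∈ X ∧ (γ u).1 ≤ g₁ n ∧ (γ u).2 ≤ g₂ n := by
      simpa [Xsub, Prod.le_def] using hu
    exact h u huX ((hg₁ n).2 _ hu₁) ((hg₂ n).2 _ hu₂)

/-- The intersection `⋂_{x ∈ σ} TelVor(x)_{p,∞}` is nonempty iff `σ ∈ Incr(γ)`
and `γ(σ) ≤ p`. -/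
theorem telVorInfIntersectionIffIncr
    {d : ℕ} (hd : 1 ≤ d) (X : Finset (Pt d)) (γ : Pt d → ℝ × ℝ)
    (hgen : GenPos X)
    (hinj1 : Set.InjOn (fun z => (γ z).1) (↑X : Set (Pt d)))
    (hinj2 : Set.InjOn (fun z => (γ z).2) (↑X : Set (Pt d)))
    (σ : Finset (Pt d)) (hne : σ.Nonempty) (hsub : σ ⊆ X)
    (p : ℝ × ℝ) :
    (⋂ x ∈ σ, TelVorInf X γ x p).Nonempty ↔
      σ ∈ Incr X γ ∧ gammaJoin γ σ hne ≤ p := by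
  have lt₁ : ∀ {u x : Pt d}, u ∈ X → x ∈ X → u ≠ x → (γ u).1 ≤ (γ x).1 → (γ u).1 < (γ x).1 :=
    fun hu hx hux hle => hle.lt_of_ne fun e => hux (hinj1 hu hx e)
  have lt₂ : ∀ {u y : Pt d}, u ∈ X → y ∈ X → u ≠ y → (γ u).2 ≤ (γ y).2 → (γ u).2 < (γ y).2 :=
    fun hu hy huy hle => hle.lt_of_ne fun e => huy (hinj2 hu hy e)
  constructor
  · rintro ⟨⟨w, s⟩, h⟩
    have hσ : ∀ z ∈ σ, (w, s) ∈ Tel X γ z ∧ s ≤ p := fun z hz => Set.mem_iInter₂.1 h z hz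
    have hs : ∀ z ∈ σ, γ z ≤ s := fun z hz => (mem_tel_iff.1 (hσ z hz).1).1
    obtain ⟨x, hx, hxmax⟩ := σ.exists_max_image (fun z => (γ z).1) hne
    obtain ⟨y, hy, hymax⟩ := σ.exists_max_image (fun z => (γ z).2) hne
    have hsp : s ≤ p := (hσ x hx).2
    have near : ∀ z ∈ σ, ∀ u ∈ Xsub X γ ((γ x).1, (γ y).2), u ≠ x → u ≠ y →
        ‖z - w‖ ≤ ‖u - w‖ := by
      intro z hz u hu hux huy
      obtain ⟨huX, hu₁, hu₂⟩ : u ∈ X ∧ (γ u).1 ≤ (γ x).1 ∧ (γ u).2 ≤ (γ y).2 := by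
        simpa [Xsub, Prod.le_def] using hu
      rw [norm_sub_rev z, norm_sub_rev u]
      exact (mem_tel_iff.1 (hσ z hz).1).2 u huX
        (.inl ((lt₁ huX (hsub hx) hux hu₁).trans_le (hs x hx).1))
        (.inl ((lt₂ huX (hsub hy) huy hu₂).trans_le (hs y hy).2))
    refine ⟨⟨hne, hsub, x, y, w, σ.sup' hne fun z => ‖z - w‖, ⟨hx, hxmax⟩, ⟨hy, hymax⟩,
      (norm_nonneg _).trans (Finset.le_sup' (fun z => ‖z - w‖) hx), fun z hz hzx hzy => ?_,
      Finset.le_sup' (fun z => ‖z - w‖) hx, Finset.le_sup' (fun z => ‖z - w‖) hy,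
      fun u hu hux huy => not_lt.2 <| Finset.sup'_le hne _ fun z hz => near z hz u hu hux huy⟩,
      ⟨Finset.sup'_le hne _ fun z hz => ((hs z hz).trans hsp).1,
        Finset.sup'_le hne _ fun z hz => ((hs z hz).trans hsp).2⟩⟩
    refine le_antisymm (Finset.le_sup' (fun z => ‖z - w‖) hz) (Finset.sup'_le hne _ fun v hv => ?_)
    exact near v hv z (by simpa [Xsub, Prod.le_def] using ⟨hsub hz, hxmax z hz, hymax z hz⟩)
      hzx hzy
  · rintro ⟨⟨-, -, x, y, c, r, ⟨hx, hxmax⟩, ⟨hy, hymax⟩, -, hon, hxr, hyr, hempty⟩, hp⟩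
    refine ⟨(c, ((γ x).1, (γ y).2)), Set.mem_iInter₂.2 fun z hz => ⟨?_, ?_⟩⟩
    · refine mem_tel_iff.2 ⟨⟨hxmax z hz, hymax z hz⟩, fun u hu h₁ h₂ => ?_⟩
      by_cases huz : u = z
      · rw [huz]
      have hux : u ≠ x := by
        rintro rfl
        rcases h₁ with h₁ | h₁
        · exact lt_irrefl _ h₁
        · exact huz (hinj1 hu (hsub hz) h₁.2.symm)
      have huy : u ≠ y := by
        rintro rfl
        rcases h₂ with h₂ | h₂
        · exact lt_irrefl _ h₂
        · exact huz (hinj2 hu (hsub hz) h₂.2.symm)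
      have hle₁ : (γ u).1 ≤ (γ x).1 := h₁.elim le_of_lt And.left
      have hle₂ : (γ u).2 ≤ (γ y).2 := h₂.elim le_of_lt And.left
      have hru : r ≤ ‖u - c‖ :=
        not_lt.1 (hempty u (by simpa [Xsub, Prod.le_def] using ⟨hu, hle₁, hle₂⟩) hux huy)
      have hzr : ‖z - c‖ ≤ r := by
        by_cases hzx : z = x
        · rwa [hzx]
        by_cases hzy : z = y
        · rwa [hzy]
        exact (hon z hz hzx hzy).le
      rw [norm_sub_rev c, norm_sub_rev c]
      exact hzr.trans hru
    · exact ⟨(Finset.le_sup' (fun z => (γ z).1) hx).trans hp.1,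
        (Finset.le_sup' (fun z => (γ z).2) hy).trans hp.2⟩
end
end

section
/- Let X ⊆ ℝ^d be finite and nonempty, r ≥ 0, and let w ∈ ℝ^d satisfy ‖w − x‖ ≤ r for some x ∈ X. Then the set V = ⋃ {Vor(x,X) : x ∈ X, ‖w − x‖ ≤ r} is star-convex with center w: w ∈ V, and for every v ∈ V the closed segment from w to v is contained in V. -/
noncomputable section

attribute [local instance] Classical.propDecidable

variable {d : ℕ}

/-- A finite nonempty set has a point whose Voronoi cell contains a given point. -/
theorem exists_mem_vorCell {d : ℕ} {X : Finset (Pt d)} (hX : X.Nonempty) (u : Pt d) :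
    ∃ y ∈ X, u ∈ VorCell y (↑X : Set (Pt d)) := by
  obtain ⟨y, hy, hmin⟩ := X.exists_min_image (fun y => ‖u - y‖) hX
  exact ⟨y, hy, fun z hz => hmin z hz⟩

/-- The difference of the squared distances to two fixed points is affine. -/
theorem norm_combo_sub_sq_sub_norm_combo_sub_sq {E : Type*} [NormedAddCommGroup E]
    [InnerProductSpace ℝ E] (w v x y : E) {a b : ℝ} (hab : a + b = 1) :
    ‖a • w + b • v - x‖ ^ 2 - ‖a • w + b • v - y‖ ^ 2 =
      a * (‖w - x‖ ^ 2 - ‖w - y‖ ^ 2) + b * (‖v - x‖ ^ 2 - ‖v - y‖ ^ 2) := by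
  obtain rfl : a = 1 - b := by linarith
  simp only [norm_sub_sq_real, inner_add_left, real_inner_smul_left]
  ring

/-- If `v` is at least as close to `x` as to `y`, and a point of the segment from `w` to `v` other
than `v` is at least as close to `y` as to `x`, then so is `w`. -/
theorem norm_sub_le_norm_sub_of_combo {E : Type*} [NormedAddCommGroup E]
    [InnerProductSpace ℝ E] {w v x y : E} {a b : ℝ} (ha : 0 < a) (hb : 0 ≤ b) (hab : a + b = 1)
    (hv : ‖v - x‖ ≤ ‖v - y‖) (hu : ‖a • w + b • v - y‖ ≤ ‖a • w + b • v - x‖) :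
    ‖w - y‖ ≤ ‖w - x‖ := by
  have hv2 := pow_le_pow_left₀ (norm_nonneg _) hv 2
  have hu2 := pow_le_pow_left₀ (norm_nonneg _) hu 2
  have haff := norm_combo_sub_sq_sub_norm_combo_sub_sq w v x y hab
  refine le_of_sq_le_sq ?_ (norm_nonneg _)
  have hbv := mul_nonneg hb (sub_nonneg.2 hv2)
  have : 0 ≤ a * (‖w - x‖ ^ 2 - ‖w - y‖ ^ 2) := by linarith
  linarith [nonneg_of_mul_nonneg_right this ha]

/-- The union of the Voronoi cells of the points of `X` within distance `r` of
`w` is star-convex with center `w`. -/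
theorem vorUnionStarConvex
    {d : ℕ} (hd : 1 ≤ d) (X : Finset (Pt d)) (hX : X.Nonempty) (r : ℝ) (hr : 0 ≤ r)
    (w : Pt d) (hw : ∃ x ∈ X, ‖w - x‖ ≤ r) :
    w ∈ (⋃ x ∈ X.filter (fun x => ‖w - x‖ ≤ r), VorCell x (↑X : Set (Pt d))) ∧
    StarConvex ℝ w (⋃ x ∈ X.filter (fun x => ‖w - x‖ ≤ r), VorCell x (↑X : Set (Pt d))) := by
  simp only [StarConvex, Set.mem_iUnion, Finset.mem_filter, exists_prop]
  constructor
  · obtain ⟨x, hx, hxr⟩ := hw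
    obtain ⟨y, hy, hwy⟩ := exists_mem_vorCell hX w
    exact ⟨y, ⟨hy, (hwy x hx).trans hxr⟩, hwy⟩
  · rintro v ⟨x, ⟨hx, hxr⟩, hv⟩ a b ha hb hab
    rcases ha.eq_or_lt with rfl | ha
    · obtain rfl : b = 1 := by linarith
      exact ⟨x, ⟨hx, hxr⟩, by simpa using hv⟩
    · obtain ⟨y, hy, hu⟩ := exists_mem_vorCell hX (a • w + b • v)
      exact ⟨y, ⟨hy, (norm_sub_le_norm_sub_of_combo ha hb hab (hv y hy) (hu x hx)).trans hxr⟩, hu⟩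
end
end

section
/- Let X ⊆ ℝ^d be finite and nonempty and r ≥ 0. Let OU_r = ⋃_{x ∈ X} Ball_r(x) × Vor(x,X) ⊆ ℝ^d × ℝ^d and Offset(X)_r = ⋃_{x ∈ X} Ball_r(x) ⊆ ℝ^d. Then the projection map OU_r → Offset(X)_r, (w,v) ↦ w, is a homotopy equivalence, with homotopy inverse w ↦ (w,w). -/
noncomputable section

attribute [local instance] Classical.propDecidable

variable {d : ℕ}

/-- The difference of the squared distances to two fixed points is an affine function. -/
theorem norm_segment_sub_sq_sub_norm_segment_sub_sq {E : Type*} [NormedAddCommGroup E]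
    [InnerProductSpace ℝ E] (w v x y : E) (t : ℝ) :
    ‖(1 - t) • w + t • v - y‖ ^ 2 - ‖(1 - t) • w + t • v - x‖ ^ 2 =
      (1 - t) * (‖w - y‖ ^ 2 - ‖w - x‖ ^ 2) + t * (‖v - y‖ ^ 2 - ‖v - x‖ ^ 2) := by
  simp only [norm_sub_sq_real, inner_add_left, real_inner_smul_left]
  ring

/-- If `v` is at least as close to `x` as to `y`, and a point of the segment from `w` to `v`
other than `v` is at least as close to `y` as to `x`, then so is `w`. -/
theorem norm_sub_le_norm_sub_of_segment {E : Type*} [NormedAddCommGroup E]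
    [InnerProductSpace ℝ E] {w v x y : E} {t : ℝ} (ht₀ : 0 ≤ t) (ht₁ : t < 1)
    (hv : ‖v - x‖ ≤ ‖v - y‖)
    (hu : ‖(1 - t) • w + t • v - y‖ ≤ ‖(1 - t) • w + t • v - x‖) :
    ‖w - y‖ ≤ ‖w - x‖ := by
  have key := norm_segment_sub_sq_sub_norm_segment_sub_sq w v x y t
  have hv' := pow_le_pow_left₀ (norm_nonneg _) hv 2
  have hu' := pow_le_pow_left₀ (norm_nonneg _) hu 2
  refine le_of_sq_le_sq ?_ (norm_nonneg _)
  by_contra! hw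
  have hw' := mul_pos (sub_pos.2 ht₁) (sub_pos.2 hw)
  have hv'' := mul_nonneg ht₀ (sub_nonneg.2 hv')
  linarith

theorem mem_OffsetR {X : Finset (Pt d)} {r : ℝ} {w : Pt d} :
    w ∈ OffsetR X r ↔ ∃ x ∈ X, ‖w - x‖ ≤ r := by
  simp [OffsetR, dist_eq_norm]

theorem mem_OUSet {X : Finset (Pt d)} {r : ℝ} {w v : Pt d} :
    (w, v) ∈ OUSet X r ↔ ∃ x ∈ X, ‖w - x‖ ≤ r ∧ ∀ y ∈ X, ‖v - x‖ ≤ ‖v - y‖ := by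
  simp [OUSet, VorCell, dist_eq_norm, and_left_comm]

theorem fst_mem_OffsetR {X : Finset (Pt d)} {r : ℝ} {z : Pt d × Pt d} (hz : z ∈ OUSet X r) :
    z.1 ∈ OffsetR X r := by
  obtain ⟨x, hx, hxr, -⟩ := mem_OUSet.1 hz
  exact mem_OffsetR.2 ⟨x, hx, hxr⟩

theorem diag_mem_OUSet {X : Finset (Pt d)} {r : ℝ} {w : Pt d} (hw : w ∈ OffsetR X r) :
    (w, w) ∈ OUSet X r := by
  obtain ⟨x, hx, hxr⟩ := mem_OffsetR.1 hw
  obtain ⟨y, hy, hmin⟩ := X.exists_min_image (fun y => ‖w - y‖) ⟨x, hx⟩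
  exact mem_OUSet.2 ⟨y, hy, (hmin x hx).trans hxr, hmin⟩

/-- The fiber of `OU_r` over `w` is star-shaped with center `w`. -/
theorem segment_mem_OUSet {X : Finset (Pt d)} {r : ℝ} {z : Pt d × Pt d} (hz : z ∈ OUSet X r)
    {t : ℝ} (ht : t ∈ Set.Icc (0 : ℝ) 1) :
    (z.1, (1 - t) • z.1 + t • z.2) ∈ OUSet X r := by
  obtain ⟨x, hx, hxr, hvor⟩ := mem_OUSet.1 hz
  rcases ht.2.eq_or_lt with rfl | ht₁
  · simpa using hz
  obtain ⟨y, hy, hmin⟩ :=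
    X.exists_min_image (fun y => ‖(1 - t) • z.1 + t • z.2 - y‖) ⟨x, hx⟩
  exact mem_OUSet.2 ⟨y, hy,
    (norm_sub_le_norm_sub_of_segment ht.1 ht₁ (hvor y hy) (hmin x hx)).trans hxr, hmin⟩

/-- The projection `OU_r → Offset(X)_r`, `(w,v) ↦ w`, is a homotopy equivalence,
with homotopy inverse `w ↦ (w,w)`. -/
theorem ouProjHomotopyEquiv
    {d : ℕ} (hd : 1 ≤ d) (X : Finset (Pt d)) (hX : X.Nonempty) (r : ℝ) (hr : 0 ≤ r) :
    ∃ (f : C(↥(OUSet X r), ↥(OffsetR X r))) (g : C(↥(OffsetR X r), ↥(OUSet X r))),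
      (∀ z : ↥(OUSet X r), (f z : Pt d) = (z : Pt d × Pt d).1) ∧
      (∀ w : ↥(OffsetR X r), (g w : Pt d × Pt d) = ((w : Pt d), (w : Pt d))) ∧
      (f.comp g).Homotopic (ContinuousMap.id ↥(OffsetR X r)) ∧
      (g.comp f).Homotopic (ContinuousMap.id ↥(OUSet X r)) := by
  refine ⟨⟨fun z => ⟨z.1.1, fst_mem_OffsetR z.2⟩, by fun_prop⟩,
    ⟨fun w => ⟨(w.1, w.1), diag_mem_OUSet w.2⟩, by fun_prop⟩,
    fun _ => rfl, fun _ => rfl, ContinuousMap.Homotopic.refl _, ⟨?_⟩⟩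
  exact
    { toFun := fun p => ⟨(p.2.1.1, (1 - (p.1 : ℝ)) • p.2.1.1 + (p.1 : ℝ) • p.2.1.2),
        segment_mem_OUSet p.2.2 p.1.2⟩
      continuous_toFun := by fun_prop
      map_zero_left := fun z => by ext1; simp
      map_one_left := fun z => by ext1; simp }
end
end

section
/- Let Z ⊆ ℝ^d be finite and in general position, let σ ∈ DelT(Z), and let R_σ be the smallest circumsphere of σ. If some point of Z lies inside R_σ (i.e., σ is not Gabriel), then there exists w ∈ Z∖σ such that σ ∪ {w} ∈ DelT(Z) and w lies inside R_σ. -/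
noncomputable section

attribute [local instance] Classical.propDecidable

variable {d : ℕ}

/-- The difference of the squared distances to two fixed points is affine along a line. -/
theorem sq_norm_sub_sq_norm_lineMap {E : Type*} [NormedAddCommGroup E] [InnerProductSpace ℝ E]
    (z s a b : E) (t : ℝ) :
    ‖z - AffineMap.lineMap a b t‖ ^ 2 - ‖s - AffineMap.lineMap a b t‖ ^ 2 =
      (1 - t) * (‖z - a‖ ^ 2 - ‖s - a‖ ^ 2) + t * (‖z - b‖ ^ 2 - ‖s - b‖ ^ 2) := by
  rw [AffineMap.lineMap_apply_module]
  simp only [norm_sub_sq_real, inner_add_right, inner_smul_right]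
  ring

/-- If `σ ∈ DelT(Z)` is not Gabriel, then `σ` has a cofacet `σ ∪ {w} ∈ DelT(Z)`
with `w` inside the smallest circumsphere of `σ`. -/
theorem cofacetOfNotGabriel
    {d : ℕ} (hd : 1 ≤ d) (Z : Finset (Pt d)) (hgen : GenPos Z)
    (σ : Finset (Pt d)) (hσ : σ ∈ DelT Z)
    (c : Pt d) (r : ℝ) (hr : 0 ≤ r) (hcirc : OnSphere c r σ)
    (hmin : ∀ c' : Pt d, ∀ r' : ℝ, 0 ≤ r' → OnSphere c' r' σ → r ≤ r')
    (hng : ∃ z ∈ Z, ‖z - c‖ < r) :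
    ∃ w ∈ Z, w ∉ σ ∧ insert w σ ∈ DelT Z ∧ ‖w - c‖ < r := by
  obtain ⟨⟨s, hs⟩, hσZ, c₀, r₀, -, hon₀, hemp₀⟩ := hσ
  obtain ⟨z₀, hz₀Z, hz₀⟩ := hng
  -- The powers of `z` with respect to the smallest and to the empty circumsphere of `σ`.
  let A : Pt d → ℝ := fun z => ‖z - c‖ ^ 2 - ‖s - c‖ ^ 2
  let B : Pt d → ℝ := fun z => ‖z - c₀‖ ^ 2 - ‖s - c₀‖ ^ 2
  have hA : ∀ z, A z < 0 ↔ ‖z - c‖ < r := fun z => by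
    simp only [A, hcirc s hs, sub_neg]
    exact pow_lt_pow_iff_left₀ (norm_nonneg _) hr two_ne_zero
  have hB : ∀ z ∈ Z, 0 ≤ B z := fun z hz => by
    have h := not_lt.1 (hemp₀ z hz)
    rw [← hon₀ s hs] at h
    exact sub_nonneg.2 (pow_le_pow_left₀ (norm_nonneg _) h 2)
  -- Move the centre from `c₀` towards `c` until the first point inside the smallest
  -- circumsphere is hit.
  obtain ⟨w, hw, hmax⟩ := (Z.filter fun z => A z < 0).exists_max_image
    (fun z => -A z / (B z - A z)) ⟨z₀, by simp [hz₀Z, hA, hz₀]⟩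
  obtain ⟨hwZ, hwA⟩ := Finset.mem_filter.1 hw
  have hwB := hB w hwZ
  set t := -A w / (B w - A w) with ht
  have hden : 0 < B w - A w := by linarith
  have ht0 : 0 ≤ t := div_nonneg (by linarith) hden.le
  have ht1 : t ≤ 1 := (div_le_one hden).2 (by linarith)
  have hpow := fun z => sq_norm_sub_sq_norm_lineMap z s c c₀ t
  have hwt : (1 - t) * A w + t * B w = 0 := by
    have := div_mul_cancel₀ (-A w) hden.ne'
    rw [← ht] at this
    linarith
  have hnonneg : ∀ z ∈ Z, 0 ≤ (1 - t) * A z + t * B z := fun z hz => by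
    have hzB := hB z hz
    by_cases hzA : A z < 0
    · have h := hmax z (Finset.mem_filter.2 ⟨hz, hzA⟩)
      rw [div_le_iff₀ (by linarith)] at h
      linarith
    · have := mul_nonneg (sub_nonneg.2 ht1) (not_lt.1 hzA)
      have := mul_nonneg ht0 hzB
      linarith
  have heq : ∀ z, (1 - t) * A z + t * B z = 0 →
      ‖z - AffineMap.lineMap c c₀ t‖ = ‖s - AffineMap.lineMap c c₀ t‖ := fun z hz =>
    (pow_left_inj₀ (norm_nonneg _) (norm_nonneg _) two_ne_zero).1
      (sub_eq_zero.1 ((hpow z).trans hz))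
  refine ⟨w, hwZ, fun hwσ => ((hA w).1 hwA).ne (hcirc w hwσ),
    ⟨Finset.insert_nonempty _ _, Finset.insert_subset hwZ hσZ, AffineMap.lineMap c c₀ t,
      ‖s - AffineMap.lineMap c c₀ t‖, norm_nonneg _, fun z hz => heq z ?_, fun z hz => ?_⟩,
    (hA w).1 hwA⟩
  · rcases Finset.mem_insert.1 hz with rfl | hz
    · exact hwt
    · simp [A, B, hcirc z hz, hcirc s hs, hon₀ z hz, hon₀ s hs]
  · exact not_lt.2 <| (pow_le_pow_iff_left₀ (norm_nonneg _) (norm_nonneg _) two_ne_zero).1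
      (sub_nonneg.1 ((hnonneg z hz).trans_eq (hpow z).symm))
end
end

section
/- Let Z ⊆ ℝ^d be finite and in general position and let σ ∈ DelT(Z) not be Gabriel (some point of Z lies inside the smallest circumsphere R_σ of σ). Then the Delaunay radius of σ equals the minimum of the Delaunay radii of its cofacets: b_σ = min { b_{σ∪{w}} : w ∈ Z∖σ and σ∪{w} ∈ DelT(Z) }, and this set of cofacets is nonempty. -/
noncomputable section

attribute [local instance] Classical.propDecidable

variable {d : ℕ}

/-- A set with a `Z`-empty circumsphere has one of least radius. -/
theorem exists_least_sphEmpty {d : ℕ} {Z σ : Finset (Pt d)} (hσ : σ ∈ DelT Z) :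
    ∃ c r, 0 ≤ r ∧ OnSphere c r σ ∧ SphEmpty c r Z ∧
      ∀ c' r', 0 ≤ r' → OnSphere c' r' σ → SphEmpty c' r' Z → r ≤ r' := by
  obtain ⟨⟨p, hp⟩, -, c₁, r₁, -, hon, hemp⟩ := hσ
  let K : Set (Pt d) :=
    {x | (∀ w ∈ σ, ‖w - x‖ = ‖p - x‖) ∧ ∀ z ∈ Z, ‖p - x‖ ≤ ‖z - x‖}
  have mem_of_sphere : ∀ c' r', OnSphere c' r' σ → SphEmpty c' r' Z → c' ∈ K :=
    fun c' r' hon' hemp' => ⟨fun w hw => (hon' w hw).trans (hon' p hp).symm,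
      fun z hz => (hon' p hp).trans_le (not_lt.1 (hemp' z hz))⟩
  have hK : IsClosed K := by
    simp only [K, Set.ofPred_and, Set.ofPred_forall]
    refine IsClosed.inter ?_ ?_
    · exact isClosed_biInter fun w _ => isClosed_eq (by fun_prop) (by fun_prop)
    · exact isClosed_biInter fun z _ => isClosed_le (by fun_prop) (by fun_prop)
  obtain ⟨c₀, hc₀, hdist⟩ := hK.exists_infDist_eq_dist ⟨c₁, mem_of_sphere c₁ r₁ hon hemp⟩ p
  refine ⟨c₀, ‖p - c₀‖, norm_nonneg _, hc₀.1, fun z hz => not_lt.2 (hc₀.2 z hz), ?_⟩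
  intro c' r' _ hon' hemp'
  have h := Metric.infDist_le_dist_of_mem (x := p) (mem_of_sphere c' r' hon' hemp')
  rwa [hdist, dist_eq_norm, dist_eq_norm, hon' p hp] at h

/-- Squared distance from `p` to a point of the line through `a` and `b`. -/
theorem norm_sub_lineMap_sq {E : Type*} [NormedAddCommGroup E] [InnerProductSpace ℝ E]
    (p a b : E) (t : ℝ) :
    ‖p - AffineMap.lineMap a b t‖ ^ 2 =
      (1 - t) * ‖p - a‖ ^ 2 + t * ‖p - b‖ ^ 2 - t * (1 - t) * ‖a - b‖ ^ 2 := by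
  have h₁ : p - AffineMap.lineMap a b t = (1 - t) • (p - a) + t • (p - b) := by
    rw [AffineMap.lineMap_apply_module]
    module
  have h₂ : a - b = (p - b) - (p - a) := by abel
  rw [h₁, h₂, norm_add_sq_real, norm_sub_sq_real (p - b), norm_smul, norm_smul, mul_pow, mul_pow,
    inner_smul_left, inner_smul_right, real_inner_comm (p - a) (p - b)]
  simp only [Real.norm_eq_abs, sq_abs, conj_trivial]
  ring

/-- A least `Z`-empty circumsphere of a set that is not Gabriel passes through a further point
of `Z`. -/
theorem exists_mem_least_sphEmpty {d : ℕ} {Z σ : Finset (Pt d)} (hne : σ.Nonempty)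
    {c : Pt d} {r : ℝ} (hcirc : OnSphere c r σ)
    (hmin : ∀ c' r', 0 ≤ r' → OnSphere c' r' σ → r ≤ r') (hng : ∃ z ∈ Z, ‖z - c‖ < r)
    {c₀ : Pt d} {r₀ : ℝ} (hr₀ : 0 ≤ r₀) (hon : OnSphere c₀ r₀ σ) (hemp : SphEmpty c₀ r₀ Z)
    (hleast : ∀ c' r', 0 ≤ r' → OnSphere c' r' σ → SphEmpty c' r' Z → r₀ ≤ r') :
    ∃ w ∈ Z, w ∉ σ ∧ ‖w - c₀‖ = r₀ := by
  by_contra! hout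
  obtain ⟨p, hp⟩ := hne
  have hc : c₀ ≠ c := by
    rintro rfl
    obtain ⟨z, hz, hzr⟩ := hng
    exact hemp z hz (hzr.trans_eq ((hcirc p hp).symm.trans (hon p hp)))
  have hr : 0 ≤ r := hcirc p hp ▸ norm_nonneg _
  have hsphere (t : ℝ) :
      OnSphere (AffineMap.lineMap c₀ c t) ‖p - AffineMap.lineMap c₀ c t‖ σ := by
    intro w hw
    rw [← sq_eq_sq₀ (norm_nonneg _) (norm_nonneg _), norm_sub_lineMap_sq, norm_sub_lineMap_sq,
      hon w hw, hon p hp, hcirc w hw, hcirc p hp]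
  have hnear : ∀ᶠ t : ℝ in nhds 0, ∀ z ∈ Z \ σ,
      ‖p - AffineMap.lineMap c₀ c t‖ < ‖z - AffineMap.lineMap c₀ c t‖ := by
    rw [Filter.eventually_all_finset]
    intro z hz
    obtain ⟨hzZ, hzσ⟩ := Finset.mem_sdiff.1 hz
    have hcont (x : Pt d) : Continuous fun t : ℝ => ‖x - AffineMap.lineMap c₀ c t‖ :=
      (continuous_const.sub AffineMap.lineMap_continuous).norm
    refine (hcont p).continuousAt.eventually_lt (hcont z).continuousAt ?_
    rw [AffineMap.lineMap_apply_zero, hon p hp]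
    exact lt_of_le_of_ne (not_lt.1 (hemp z hzZ)) (hout z hzZ hzσ).symm
  obtain ⟨t, ht, ht₀, ht₁⟩ := ((hnear.filter_mono nhdsWithin_le_nhds).and
    (Ioo_mem_nhdsGT (zero_lt_one' ℝ))).exists
  have hempty : SphEmpty (AffineMap.lineMap c₀ c t) ‖p - AffineMap.lineMap c₀ c t‖ Z := by
    intro z hz
    by_cases hzσ : z ∈ σ
    · exact (hsphere t z hzσ).not_lt
    · exact (ht z (Finset.mem_sdiff.2 ⟨hz, hzσ⟩)).not_gt
  have hle := hleast _ _ (norm_nonneg _) (hsphere t) hempty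
  have hsq := norm_sub_lineMap_sq p c₀ c t
  rw [hon p hp, hcirc p hp] at hsq
  have hle_sq := pow_le_pow_left₀ hr₀ hle 2
  have hr_sq := pow_le_pow_left₀ hr (hmin c₀ r₀ hr₀ hon) 2
  have hpos : 0 < t * (1 - t) * ‖c₀ - c‖ ^ 2 :=
    mul_pos (mul_pos ht₀ (sub_pos.2 ht₁)) (pow_pos (norm_pos_iff.2 (sub_ne_zero.2 hc)) 2)
  nlinarith [mul_le_mul_of_nonneg_left hr_sq ht₀.le]

/-- The radius of a least `Z`-empty circumsphere is the Delaunay radius. -/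
theorem delRad_eq_of_least {d : ℕ} {Z σ : Finset (Pt d)} {c : Pt d} {r : ℝ} (hr : 0 ≤ r)
    (hon : OnSphere c r σ) (hemp : SphEmpty c r Z)
    (hleast : ∀ c' r', 0 ≤ r' → OnSphere c' r' σ → SphEmpty c' r' Z → r ≤ r') :
    delRad Z σ = r :=
  IsLeast.csInf_eq ⟨⟨hr, c, hon, hemp⟩, fun r' ⟨hr', c', hon', hemp'⟩ =>
    hleast c' r' hr' hon' hemp'⟩

/-- The Delaunay radius is monotone on the Delaunay triangulation. -/
theorem delRad_mono {d : ℕ} {Z σ τ : Finset (Pt d)} (hστ : σ ⊆ τ) (hτ : τ ∈ DelT Z) :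
    delRad Z σ ≤ delRad Z τ := by
  obtain ⟨-, -, c, r, hr, hon, hemp⟩ := hτ
  exact csInf_le_csInf ⟨0, fun _ h => h.1⟩ ⟨r, hr, c, hon, hemp⟩
    fun _ ⟨hr', c', hon', hemp'⟩ => ⟨hr', c', fun w hw => hon' w (hστ hw), hemp'⟩

/-- If `σ ∈ DelT(Z)` is not Gabriel, then `b_σ` equals the minimum of the
Delaunay radii of its cofacets, and the set of cofacets is nonempty. -/
theorem delRadCofacetFormula
    {d : ℕ} (hd : 1 ≤ d) (Z : Finset (Pt d)) (hgen : GenPos Z)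
    (σ : Finset (Pt d)) (hσ : σ ∈ DelT Z)
    (c : Pt d) (r : ℝ) (hr : 0 ≤ r) (hcirc : OnSphere c r σ)
    (hmin : ∀ c' : Pt d, ∀ r' : ℝ, 0 ≤ r' → OnSphere c' r' σ → r ≤ r')
    (hng : ∃ z ∈ Z, ‖z - c‖ < r) :
    ∃ w ∈ Z, w ∉ σ ∧ insert w σ ∈ DelT Z ∧
      delRad Z σ = delRad Z (insert w σ) ∧
      ∀ w' ∈ Z, w' ∉ σ → insert w' σ ∈ DelT Z →
        delRad Z σ ≤ delRad Z (insert w' σ) := by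
  obtain ⟨c₀, r₀, hr₀, hon, hemp, hleast⟩ := exists_least_sphEmpty hσ
  obtain ⟨w, hwZ, hwσ, hw⟩ :=
    exists_mem_least_sphEmpty hσ.1 hcirc hmin hng hr₀ hon hemp hleast
  have hon' : OnSphere c₀ r₀ (insert w σ) := fun x hx =>
    (Finset.mem_insert.1 hx).elim (fun h => h ▸ hw) (hon x)
  refine ⟨w, hwZ, hwσ, ⟨Finset.insert_nonempty w σ, Finset.insert_subset hwZ hσ.2.1,
    c₀, r₀, hr₀, hon', hemp⟩, ?_, fun w' _ _ h => delRad_mono (Finset.subset_insert w' σ) h⟩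
  rw [delRad_eq_of_least hr₀ hon hemp hleast, delRad_eq_of_least hr₀ hon' hemp]
  exact fun c' r' hr' h => hleast c' r' hr' fun x hx => h x (Finset.mem_insert_of_mem hx)
end
end

section
/- Let σ ∈ Incr(γ) with x = max₁(σ), y = max₂(σ), τ = σ∖{x,y}, and let S_σ be the smallest circumsphere of τ such that x and y each lie inside or on it. If σ is not Incr-Gabriel (some point of X_{γ(σ)}∖{x,y} lies inside S_σ), then there exists w ∈ X∖σ such that σ ∪ {w} ∈ Incr(γ) and w lies inside S_σ. -/
noncomputable section

attribute [local instance] Classical.propDecidable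

variable {d : ℕ}

/-- The affine combinations of the power functions of two spheres are, up to the sign of the
squared radius, power functions of spheres. -/
theorem exists_power_eq_affine_combination {d : ℕ} (c₀ c₁ : Pt d) (s₀ s₁ t : ℝ) :
    ∃ (c : Pt d) (s : ℝ), ∀ z : Pt d,
      ‖z - c‖ ^ 2 - s = (1 - t) * (‖z - c₀‖ ^ 2 - s₀) + t * (‖z - c₁‖ ^ 2 - s₁) := by
  refine ⟨(1 - t) • c₀ + t • c₁, ‖(1 - t) • c₀ + t • c₁‖ ^ 2
    - ((1 - t) * (‖c₀‖ ^ 2 - s₀) + t * (‖c₁‖ ^ 2 - s₁)), fun z => ?_⟩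
  simp only [norm_sub_sq_real z, inner_add_right, inner_smul_right]
  ring

/-- If the affine function with values `f a` at `0` and `g a` at `1` is nonnegative at `1` for every
`a ∈ A` and negative at `0` for some `a ∈ A`, then there is a time `t ∈ [0, 1]` at which all these
functions are nonnegative and one that started negative vanishes. -/
theorem exists_last_crossing {α : Type*} (A : Finset α) (f g : α → ℝ)
    (hg : ∀ a ∈ A, 0 ≤ g a) (hf : ∃ a ∈ A, f a < 0) :
    ∃ t, 0 ≤ t ∧ t ≤ 1 ∧ (∀ a ∈ A, 0 ≤ (1 - t) * f a + t * g a) ∧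
      ∃ a ∈ A, f a < 0 ∧ (1 - t) * f a + t * g a = 0 := by
  obtain ⟨w, hw, hwmax⟩ := (A.filter fun a => f a < 0).exists_max_image
    (fun a => f a / (f a - g a)) (by simpa [Finset.Nonempty] using hf)
  rw [Finset.mem_filter] at hw
  obtain ⟨hwA, hwf⟩ := hw
  have hwg := hg w hwA
  have hne : f w - g w ≠ 0 := by linarith
  have ht₀ : 0 ≤ f w / (f w - g w) := div_nonneg_of_nonpos hwf.le (by linarith)
  have ht₁ : f w / (f w - g w) ≤ 1 := (div_le_one_of_neg (by linarith)).2 (by linarith)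
  refine ⟨f w / (f w - g w), ht₀, ht₁, fun a ha => ?_, w, hwA, hwf, by field_simp; ring⟩
  have hga := hg a ha
  rcases lt_or_ge (f a) 0 with hfa | hfa
  · have hle := hwmax a (Finset.mem_filter.2 ⟨ha, hfa⟩)
    have h := (div_le_iff_of_neg (by linarith : f a - g a < 0)).1 hle
    linarith
  · exact add_nonneg (mul_nonneg (by linarith) hfa) (mul_nonneg ht₀ hga)

/-- If `σ ∈ Incr(γ)` is not Incr-Gabriel, then `σ` has a cofacet
`σ ∪ {w} ∈ Incr(γ)` with `w` inside `S_σ`. -/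
theorem incrCofacetOfNotIncrGabriel
    {d : ℕ} (hd : 1 ≤ d) (X : Finset (Pt d)) (γ : Pt d → ℝ × ℝ)
    (hgen : GenPos X)
    (hinj1 : Set.InjOn (fun z => (γ z).1) (↑X : Set (Pt d)))
    (hinj2 : Set.InjOn (fun z => (γ z).2) (↑X : Set (Pt d)))
    (σ : Finset (Pt d)) (hσ : σ ∈ Incr X γ)
    (x y : Pt d) (hx : IsMax1 γ σ x) (hy : IsMax2 γ σ y)
    (c : Pt d) (r : ℝ) (hr : 0 ≤ r)
    (hcirc : ∀ z ∈ σ, z ≠ x → z ≠ y → ‖z - c‖ = r)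
    (hxin : ‖x - c‖ ≤ r) (hyin : ‖y - c‖ ≤ r)
    (hmin : ∀ c' : Pt d, ∀ r' : ℝ, 0 ≤ r' →
      (∀ z ∈ σ, z ≠ x → z ≠ y → ‖z - c'‖ = r') →
      ‖x - c'‖ ≤ r' → ‖y - c'‖ ≤ r' → r ≤ r')
    (hng : ∃ w ∈ Xsub X γ ((γ x).1, (γ y).2), w ≠ x ∧ w ≠ y ∧ ‖w - c‖ < r) :
    ∃ w ∈ X, w ∉ σ ∧ insert w σ ∈ Incr X γ ∧ ‖w - c‖ < r := by
  obtain ⟨-, hσX, x', y', c₁, r₁, hx', hy', hr₁, hcirc₁, hxin₁, hyin₁, hempty₁⟩ := hσ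
  obtain rfl : x' = x := hinj1 (hσX hx'.1) (hσX hx.1) (le_antisymm (hx.2 _ hx'.1) (hx'.2 _ hx.1))
  obtain rfl : y' = y := hinj2 (hσX hy'.1) (hσX hy.1) (le_antisymm (hy.2 _ hy'.1) (hy'.2 _ hy.1))
  obtain ⟨t, ht₀, ht₁, hnonneg, w, hwA, hwneg, hwzero⟩ := exists_last_crossing
    ((Xsub X γ ((γ x').1, (γ y').2)).filter fun z => z ≠ x' ∧ z ≠ y')
    (fun z => ‖z - c‖ ^ 2 - r ^ 2) (fun z => ‖z - c₁‖ ^ 2 - r₁ ^ 2)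
    (fun z hz => by
      obtain ⟨hz, hzx, hzy⟩ := Finset.mem_filter.1 hz
      exact sub_nonneg.2 (pow_le_pow_left₀ hr₁ (not_lt.1 (hempty₁ z hz hzx hzy)) 2))
    (by
      obtain ⟨w, hw, hwx, hwy, hlt⟩ := hng
      exact ⟨w, Finset.mem_filter.2 ⟨hw, hwx, hwy⟩,
        sub_neg.2 (pow_lt_pow_left₀ hlt (norm_nonneg _) two_ne_zero)⟩)
  obtain ⟨hwsub, hwx, hwy⟩ := Finset.mem_filter.1 hwA
  obtain ⟨hwX, hwγ⟩ := Finset.mem_filter.1 hwsub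
  have hwin : ‖w - c‖ < r := lt_of_pow_lt_pow_left₀ 2 hr (sub_neg.1 hwneg)
  obtain ⟨c₂, s, hpow⟩ := exists_power_eq_affine_combination c c₁ (r ^ 2) (r₁ ^ 2) t
  have hin : ∀ z, ‖z - c‖ ≤ r → ‖z - c₁‖ ≤ r₁ → ‖z - c₂‖ ^ 2 ≤ s := fun z h h₁ => by
    have h' := mul_nonneg (sub_nonneg.2 ht₁) (sub_nonneg.2 (pow_le_pow_left₀ (norm_nonneg _) h 2))
    have h₁' := mul_nonneg ht₀ (sub_nonneg.2 (pow_le_pow_left₀ (norm_nonneg _) h₁ 2))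
    linarith [hpow z]
  have hs : 0 ≤ s := (sq_nonneg _).trans (hin x' hxin hxin₁)
  have hon : ∀ z, ‖z - c₂‖ ^ 2 = s → ‖z - c₂‖ = √s := fun z h => by
    rw [← h, Real.sqrt_sq (norm_nonneg _)]
  refine ⟨w, hwX, fun hwσ => hwin.ne (hcirc w hwσ hwx hwy), ⟨Finset.insert_nonempty _ _,
    Finset.insert_subset hwX hσX, x', y', c₂, √s, ⟨Finset.mem_insert_of_mem hx.1, ?_⟩,
    ⟨Finset.mem_insert_of_mem hy.1, ?_⟩, Real.sqrt_nonneg s, ?_,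
    Real.le_sqrt_of_sq_le (hin x' hxin hxin₁), Real.le_sqrt_of_sq_le (hin y' hyin hyin₁), ?_⟩,
    hwin⟩
  · exact Finset.forall_mem_insert _ _ _ |>.2 ⟨hwγ.1, hx.2⟩
  · exact Finset.forall_mem_insert _ _ _ |>.2 ⟨hwγ.2, hy.2⟩
  · refine Finset.forall_mem_insert _ _ _ |>.2 ⟨fun _ _ => hon w ?_, fun z hz hzx hzy => hon z ?_⟩
    · linarith [hpow w]
    · have h := hpow z
      rw [hcirc z hz hzx hzy, hcirc₁ z hz hzx hzy] at h
      linarith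
  · intro z hz hzx hzy
    have h := hnonneg z (Finset.mem_filter.2 ⟨hz, hzx, hzy⟩)
    exact not_lt.2 (Real.sqrt_le_left (norm_nonneg _) |>.2 (by linarith [hpow z]))
end
end
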